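/- Let (λ_m)_{m≥0} be a real sequence with λ_m = 3·(5−λ_{m+1})·(4−λ_{m+1})·(3−λ_{m+1})·λ_{m+1}/(14 − 3λ_{m+1}) for all m ≥ 0, such that φ(λ_m) ≠ 0 and 14 − 3λ_m ≠ 0 for all m, λ_0 ≠ 0, and (90/7)^m·λ_m → (2/3)·λ as m → ∞. Define s_0 = 1 and s_{m+1} = δ(λ_{m+1})·s_m. Then for every m ≥ 0, s_m = (λ_m/λ_0) · ∏_{j=1}^m (4−λ_j)(6−λ_j)/(4 − 6λ_j + λ_j²), and lim_{m→∞} (15/7)^m · s_m = τ(λ), the infinite product defining τ(λ) being convergent. (Consequently the normal derivative of the λ-eigenfunction on SG₃ with boundary values (0,1,0) at a boundary point where it vanishes equals −τ(λ).) -/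

import Mathlib

open Filter Topology

/-- `φ(λ) = 3(5−λ)(3−λ)(4−6λ+λ²)` for `SG₃`. -/
noncomputable def phiSG3 (l : ℝ) : ℝ := 3 * (5 - l) * (3 - l) * (4 - 6*l + l^2)

/-- `δ(λ) = (14 − 3λ)(6 − λ)/φ(λ)`. -/
noncomputable def deltaSG3 (l : ℝ) : ℝ := (14 - 3*l) * (6 - l) / phiSG3 l

/-- For a perturbation of the form `f(x) = 1 + x g(x)` with `g` continuous at `0`, the product
`∏ f(x_j)` along a geometrically decaying sequence converges. -/
theorem multipliable_one_add_mul_of_tendsto_pow_mul {x : ℕ → ℝ} {r a : ℝ} (hr : 1 < r)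
    (hx : Tendsto (fun m => r ^ m * x m) atTop (𝓝 a)) {g : ℝ → ℝ} (hg : ContinuousAt g 0) :
    Multipliable fun m => 1 + x m * g (x m) := by
  have hr0 : r ≠ 0 := by positivity
  have hpow : Tendsto (fun m : ℕ => r⁻¹ ^ m) atTop (𝓝 0) :=
    tendsto_pow_atTop_nhds_zero_of_lt_one (by positivity) (inv_lt_one_of_one_lt₀ hr)
  have hxr : ∀ m, x m = r⁻¹ ^ m * (r ^ m * x m) := fun m => by
    rw [← mul_assoc, ← mul_pow, inv_mul_cancel₀ hr0, one_pow, one_mul]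
  have hx0 : Tendsto x atTop (𝓝 0) := by
    have h := hpow.mul hx
    rw [zero_mul] at h
    exact h.congr fun m => (hxr m).symm
  have hbdd : (fun m => r ^ m * x m * g (x m)) =O[atTop] fun _ => (1 : ℝ) :=
    (hx.mul (hg.tendsto.comp hx0)).isBigO_one ℝ
  have hO : (fun m => x m * g (x m)) =O[atTop] fun m => r⁻¹ ^ m := by
    refine ((Asymptotics.isBigO_refl (fun m : ℕ => r⁻¹ ^ m) atTop).mul hbdd).congr
      (fun m => ?_) fun m => mul_one _
    rw [← mul_assoc, ← hxr]
  have hsum : Summable fun m => x m * g (x m) :=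
    summable_of_isBigO_nat
      (summable_geometric_of_lt_one (by positivity) (inv_lt_one_of_one_lt₀ hr)) hO
  exact Real.multipliable_one_add_of_summable hsum

/-- Closed form and limit of the sequence `s_m`; the normal derivative of the
`λ`-eigenfunction on `SG₃` with boundary values `(0,1,0)` at a boundary point where
it vanishes equals `−τ(λ)`, with `τ(λ) = (2λ/(3λ₀))·∏_{j≥1}(…)`. -/
theorem sg3_normal_derivative_q1
    (lam : ℕ → ℝ) (L : ℝ)
    (hrec : ∀ m : ℕ, lam m =
      3 * (5 - lam (m+1)) * (4 - lam (m+1)) * (3 - lam (m+1)) * lam (m+1) /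
        (14 - 3 * lam (m+1)))
    (hphi : ∀ m : ℕ, phiSG3 (lam m) ≠ 0)
    (h14 : ∀ m : ℕ, 14 - 3 * lam m ≠ 0)
    (h0 : lam 0 ≠ 0)
    (hlim : Tendsto (fun m : ℕ => (90/7 : ℝ) ^ m * lam m) atTop (𝓝 (2/3 * L)))
    (s : ℕ → ℝ) (hs0 : s 0 = 1)
    (hss : ∀ m : ℕ, s (m+1) = deltaSG3 (lam (m+1)) * s m) :
    (∀ m : ℕ, s m =
      lam m / lam 0 *
        ∏ j ∈ Finset.Icc 1 m, (4 - lam j) * (6 - lam j) / (4 - 6 * lam j + (lam j)^2)) ∧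
    ∃ p : ℝ,
      Tendsto (fun n : ℕ => ∏ j ∈ Finset.Icc 1 n,
          ((1 - lam j / 4) * (1 - lam j / 6) / (1 - 3/2 * lam j + (lam j)^2 / 4)))
        atTop (𝓝 p) ∧
      Tendsto (fun m : ℕ => (15/7 : ℝ) ^ m * s m) atTop
        (𝓝 (2 * L / (3 * lam 0) * p)) := by
  have hden : ∀ m, 4 - 6 * lam m + lam m ^ 2 ≠ 0 := fun m => right_ne_zero_of_mul (hphi m)
  have h5 : ∀ m, 5 - lam m ≠ 0 := fun m =>
    right_ne_zero_of_mul (left_ne_zero_of_mul (left_ne_zero_of_mul (hphi m)))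
  have h3 : ∀ m, 3 - lam m ≠ 0 := fun m =>
    right_ne_zero_of_mul (left_ne_zero_of_mul (hphi m))
  have hclosed : ∀ m : ℕ, s m = lam m / lam 0 *
      ∏ j ∈ Finset.Icc 1 m, (4 - lam j) * (6 - lam j) / (4 - 6 * lam j + (lam j)^2) := by
    intro m
    induction m with
    | zero => simp [hs0, h0]
    | succ m ih =>
      have hratio : deltaSG3 (lam (m + 1)) * lam m = lam (m + 1) *
          ((4 - lam (m + 1)) * (6 - lam (m + 1)) /
            (4 - 6 * lam (m + 1) + lam (m + 1) ^ 2)) := by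
        have := h5 (m + 1)
        have := h3 (m + 1)
        have := hden (m + 1)
        have := h14 (m + 1)
        rw [hrec m, deltaSG3, phiSG3]
        field_simp
      rw [hss, ih, Finset.prod_Icc_succ_top (by omega)]
      linear_combination (∏ j ∈ Finset.Icc 1 m,
        (4 - lam j) * (6 - lam j) / (4 - 6 * lam j + (lam j)^2)) / lam 0 * hratio
  refine ⟨hclosed, ?_⟩
  have hquarter : ∀ m, 1 - 3/2 * lam m + (lam m)^2 / 4 = (4 - 6 * lam m + lam m ^ 2) / 4 :=
    fun m => by ring
  have hfactor : ∀ m, (1 - lam m / 4) * (1 - lam m / 6) / (1 - 3/2 * lam m + (lam m)^2 / 4) =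
      1 + lam m * ((13/12 - 5/24 * lam m) / (1 - 3/2 * lam m + (lam m)^2 / 4)) := by
    intro m
    have hD : 1 - 3/2 * lam m + (lam m)^2 / 4 ≠ 0 := by
      rw [hquarter]
      exact div_ne_zero (hden m) four_ne_zero
    rw [mul_div_assoc', one_add_div hD]
    ring
  have hmul : Multipliable fun m => (1 - lam (m + 1) / 4) * (1 - lam (m + 1) / 6) /
      (1 - 3/2 * lam (m + 1) + (lam (m + 1))^2 / 4) := by
    simp only [hfactor]
    have hshift : Tendsto (fun m : ℕ => (90/7 : ℝ) ^ m * lam (m + 1)) atTop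
        (𝓝 ((90/7)⁻¹ * (2/3 * L))) :=
      ((hlim.comp (tendsto_add_atTop_nat 1)).const_mul (90/7 : ℝ)⁻¹).congr fun m => by
        simp only [Function.comp_apply, pow_succ]
        ring
    refine multipliable_one_add_mul_of_tendsto_pow_mul (by norm_num) hshift
      (g := fun x => (13/12 - 5/24 * x) / (1 - 3/2 * x + x^2 / 4)) ?_
    exact ContinuousAt.div (by fun_prop) (by fun_prop) (by norm_num)
  obtain ⟨p, hp⟩ : ∃ p : ℝ, Tendsto (fun n : ℕ => ∏ j ∈ Finset.Icc 1 n,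
      ((1 - lam j / 4) * (1 - lam j / 6) / (1 - 3/2 * lam j + (lam j)^2 / 4)))
      atTop (𝓝 p) := by
    refine ⟨_, hmul.hasProd.tendsto_prod_nat.congr fun n => ?_⟩
    rw [Finset.range_eq_Ico, Finset.prod_Ico_add' (fun j => (1 - lam j / 4) * (1 - lam j / 6) /
      (1 - 3/2 * lam j + (lam j)^2 / 4)) 0 n 1]
    rfl
  refine ⟨p, hp, ?_⟩
  have hscale : ∀ m, (4 - lam m) * (6 - lam m) / (4 - 6 * lam m + (lam m)^2) =
      6 * ((1 - lam m / 4) * (1 - lam m / 6) / (1 - 3/2 * lam m + (lam m)^2 / 4)) := by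
    intro m
    have := hden m
    rw [hquarter]
    field_simp
  have h := (hlim.div_const (lam 0)).mul hp
  rw [show 2 * L / (3 * lam 0) * p = 2/3 * L / lam 0 * p by field_simp]
  refine h.congr fun m => ?_
  simp only [hclosed, hscale, Finset.prod_mul_distrib, Finset.prod_const, Nat.card_Icc,
    Nat.add_sub_cancel]
  rw [show (90/7 : ℝ) = 15/7 * 6 by norm_num, mul_pow]
  ring
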